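/- Let X be a discrete proper metric space with basepoint. For all n ≥ 1, k ≥ 0 and R > 0 there is a constant M ≥ 0 (one may take M = (n+1)·(R+1)^k) such that for every R-controlled φ ∈ C_n(X), the boundary δφ ∈ C_{n−1}(X) is R-controlled and ‖δφ‖^k_{n−1} ≤ M·‖φ‖^k_n. In particular δ extends to a bounded linear operator between the tempered chain spaces Sch^k C_n(X) → Sch^k C_{n−1}(X). -/

import Mathlib

open Finsupp

/-- A tuple is degenerate if two consecutive entries agree. -/
def IsDegen {X : Type*} {n : ℕ} (t : Fin (n + 1) → X) : Prop :=
  ∃ j : Fin n, t j.castSucc = t j.succ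

open Classical in
/-- The image of a basis vector under the projection `p` killing degenerate tuples. -/
noncomputable def csingle {X : Type*} {n : ℕ} (t : Fin (n + 1) → X) :
    (Fin (n + 1) → X) →₀ ℝ :=
  if IsDegen t then 0 else Finsupp.single t 1

/-- Membership in `C_n(X)`: finitely supported chains vanishing on degenerate tuples. -/
def MemC {X : Type*} {n : ℕ} (φ : (Fin (n + 1) → X) →₀ ℝ) : Prop :=
  ∀ t, IsDegen t → φ t = 0

/-- The simplicial boundary map `δ : C_{n+1}(X) → C_n(X)`. -/
noncomputable def bdry {X : Type*} {n : ℕ} :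
    ((Fin (n + 2) → X) →₀ ℝ) →ₗ[ℝ] ((Fin (n + 1) → X) →₀ ℝ) :=
  Finsupp.linearCombination ℝ
    (fun t => ∑ j : Fin (n + 2), ((-1 : ℝ) ^ (j : ℕ)) • csingle (t ∘ j.succAbove))

/-- The induced chain map `f_* : C_n(X) → C_n(Y)`. -/
noncomputable def pushf {X Y : Type*} (f : X → Y) {n : ℕ} :
    ((Fin (n + 1) → X) →₀ ℝ) →ₗ[ℝ] ((Fin (n + 1) → Y) →₀ ℝ) :=
  Finsupp.linearCombination ℝ (fun t => csingle (f ∘ t))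

/-- The prism tuple `(f(x_0),…,f(x_j),f'(x_j),…,f'(x_n))`. -/
def prism {X Y : Type*} (f f' : X → Y) {n : ℕ} (j : Fin (n + 1)) (t : Fin (n + 1) → X) :
    Fin (n + 2) → Y :=
  fun i =>
    if h : (i : ℕ) ≤ (j : ℕ) then f (t ⟨i, by have := j.isLt; omega⟩)
    else f' (t ⟨(i : ℕ) - 1, by have := i.isLt; omega⟩)

/-- The elementary homotopy `H(f,f') : C_n(X) → C_{n+1}(Y)`. -/
noncomputable def hmap {X Y : Type*} (f f' : X → Y) {n : ℕ} :
    ((Fin (n + 1) → X) →₀ ℝ) →ₗ[ℝ] ((Fin (n + 2) → Y) →₀ ℝ) :=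
  Finsupp.linearCombination ℝ
    (fun t => ∑ j : Fin (n + 1), ((-1 : ℝ) ^ (j : ℕ)) • csingle (prism f f' j t))

/-- `φ` is `R`-controlled: it vanishes on tuples with two entries at distance `> R`. -/
def Controlled {X : Type*} [MetricSpace X] (R : ℝ) {n : ℕ}
    (φ : (Fin (n + 1) → X) →₀ ℝ) : Prop :=
  ∀ t : Fin (n + 1) → X, (∃ i j, R < dist (t i) (t j)) → φ t = 0

/-- The weighted ℓ¹-norm `‖φ‖^k_n = Σ_t |φ(t)|·(d(t_0,pt)+1)^k` on `C_n(X)`. -/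
noncomputable def chainNorm {X : Type*} [MetricSpace X] (pt : X) (k : ℝ) {n : ℕ}
    (φ : (Fin (n + 1) → X) →₀ ℝ) : ℝ :=
  ∑ t ∈ φ.support, |φ t| * (dist (t 0) pt + 1) ^ k

lemma chainNorm_eq_of_subset {X : Type*} [MetricSpace X] (pt : X) (k : ℝ) {n : ℕ}
    (φ : (Fin (n + 1) → X) →₀ ℝ) (S : Finset (Fin (n + 1) → X)) (h : φ.support ⊆ S) :
    chainNorm pt k φ = ∑ t ∈ S, |φ t| * (dist (t 0) pt + 1) ^ k := by
  unfold chainNorm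
  refine Finset.sum_subset h ?_
  intro t _ ht
  rw [Finsupp.notMem_support_iff.mp ht]; simp

lemma chainNorm_add_le {X : Type*} [MetricSpace X] (pt : X) (k : ℝ) {n : ℕ}
    (φ ψ : (Fin (n + 1) → X) →₀ ℝ) :
    chainNorm pt k (φ + ψ) ≤ chainNorm pt k φ + chainNorm pt k ψ := by
  classical
  rw [chainNorm_eq_of_subset pt k (φ + ψ) (φ.support ∪ ψ.support) Finsupp.support_add,
    chainNorm_eq_of_subset pt k φ (φ.support ∪ ψ.support) Finset.subset_union_left,
    chainNorm_eq_of_subset pt k ψ (φ.support ∪ ψ.support) Finset.subset_union_right,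
    ← Finset.sum_add_distrib]
  refine Finset.sum_le_sum fun t _ => ?_
  rw [← add_mul]
  have : 0 ≤ (dist (t 0) pt + 1) ^ k := by positivity
  exact mul_le_mul_of_nonneg_right (abs_add_le _ _) this

lemma chainNorm_smul_le {X : Type*} [MetricSpace X] (pt : X) (k : ℝ) {n : ℕ}
    (c : ℝ) (φ : (Fin (n + 1) → X) →₀ ℝ) :
    chainNorm pt k (c • φ) = |c| * chainNorm pt k φ := by
  rw [chainNorm_eq_of_subset pt k (c • φ) φ.support Finsupp.support_smul, chainNorm,
    Finset.mul_sum]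
  refine Finset.sum_congr rfl fun t _ => ?_
  simp [abs_mul, mul_assoc]

lemma chainNorm_sum_le {X : Type*} [MetricSpace X] (pt : X) (k : ℝ) {n : ℕ} {ι : Type*}
    (s : Finset ι) (f : ι → (Fin (n + 1) → X) →₀ ℝ) :
    chainNorm pt k (∑ i ∈ s, f i) ≤ ∑ i ∈ s, chainNorm pt k (f i) := by
  classical
  induction s using Finset.induction_on with
  | empty => simp [chainNorm]
  | insert a s ha ih =>
    rw [Finset.sum_insert ha, Finset.sum_insert ha]
    exact (chainNorm_add_le pt k _ _).trans (by gcongr)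

lemma chainNorm_csingle_le {X : Type*} [MetricSpace X] (pt : X) (k : ℝ) {n : ℕ}
    (t : Fin (n + 1) → X) :
    chainNorm pt k (csingle t) ≤ (dist (t 0) pt + 1) ^ k := by
  unfold csingle
  split_ifs
  · simp only [chainNorm, Finsupp.support_zero, Finset.sum_empty]; positivity
  · rw [chainNorm_eq_of_subset pt k _ {t} Finsupp.support_single_subset]
    simp

lemma csingle_apply_ne {X : Type*} {n : ℕ} {t u : Fin (n + 1) → X} (h : t ≠ u) :
    csingle t u = 0 := by
  unfold csingle
  split_ifs
  · rfl
  · exact Finsupp.single_eq_of_ne h.symm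

/-- Let `X` be a discrete proper metric space with basepoint.  For all
`n ≥ 1`, `k ≥ 0` and `R > 0`, with `M = (n+1)·(R+1)^k` (here the chains below have degree
`n+1`, so `M = (n+2)·(R+1)^k` in the indexing used), every `R`-controlled `φ ∈ C_n(X)` has
`R`-controlled boundary `δφ` with `‖δφ‖^k_{n-1} ≤ M·‖φ‖^k_n`; hence `δ` extends to a
bounded operator `Sch^kC_n(X) → Sch^kC_{n-1}(X)`. -/
theorem statement19 {X : Type*} [MetricSpace X]
    (hX : ∀ s : Set X, Bornology.IsBounded s → s.Finite) (pt : X) :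
    ∀ (n : ℕ) (k R : ℝ), 0 ≤ k → 0 < R →
      ∀ φ : (Fin (n + 2) → X) →₀ ℝ, MemC φ → Controlled R φ →
        Controlled R (bdry φ) ∧
        chainNorm pt k (bdry φ) ≤ ((n : ℝ) + 2) * (R + 1) ^ k * chainNorm pt k φ := by
  intro n k R hk hR φ _ hφ
  have hd : ∀ t ∈ φ.support, ∀ i j, dist (t i) (t j) ≤ R := by
    intro t ht i j
    by_contra h
    exact (Finsupp.mem_support_iff.mp ht) (hφ t ⟨i, j, not_le.mp h⟩)
  have hb : bdry φ = ∑ t ∈ φ.support, φ t •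
      ∑ j : Fin (n + 2), ((-1 : ℝ) ^ (j : ℕ)) • csingle (t ∘ j.succAbove) := by
    rw [bdry, Finsupp.linearCombination_apply, Finsupp.sum]
  constructor
  · rintro u ⟨a, b, hab⟩
    rw [hb, Finsupp.finset_sum_apply]
    refine Finset.sum_eq_zero fun t ht => ?_
    rw [Finsupp.smul_apply, Finsupp.finset_sum_apply, Finset.sum_eq_zero, smul_zero]
    intro j _
    rw [Finsupp.smul_apply, csingle_apply_ne, smul_zero]
    rintro rfl
    exact absurd (hd t ht _ _) (not_le.mpr hab)
  · rw [hb]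
    refine (chainNorm_sum_le pt k _ _).trans ?_
    rw [chainNorm, Finset.mul_sum]
    refine Finset.sum_le_sum fun t ht => ?_
    rw [chainNorm_smul_le]
    have key : ∀ j : Fin (n + 2),
        chainNorm pt k (((-1 : ℝ) ^ (j : ℕ)) • csingle (t ∘ j.succAbove)) ≤
          (R + 1) ^ k * (dist (t 0) pt + 1) ^ k := by
      intro j
      rw [chainNorm_smul_le, abs_pow, abs_neg, abs_one, one_pow, one_mul]
      refine (chainNorm_csingle_le pt k _).trans ?_
      rw [← Real.mul_rpow (by positivity) (by positivity)]
      refine Real.rpow_le_rpow (by positivity) ?_ hk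
      have h1 := dist_triangle ((t ∘ j.succAbove) 0) (t 0) pt
      have h2 : dist ((t ∘ j.succAbove) 0) (t 0) ≤ R := hd t ht _ _
      nlinarith [mul_nonneg hR.le (dist_nonneg (x := t 0) (y := pt))]
    have h3 := (chainNorm_sum_le pt k Finset.univ
      (fun j : Fin (n + 2) => ((-1 : ℝ) ^ (j : ℕ)) • csingle (t ∘ j.succAbove))).trans
      (Finset.sum_le_sum fun j _ => key j)
    rw [Finset.sum_const, Finset.card_univ, Fintype.card_fin, nsmul_eq_mul] at h3
    push_cast at h3
    calc _ ≤ |φ t| * (((n : ℝ) + 2) * ((R + 1) ^ k * (dist (t 0) pt + 1) ^ k)) :=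
          mul_le_mul_of_nonneg_left h3 (abs_nonneg _)
      _ = _ := by ring
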